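/- arXiv:1501.00329 — 2 statements merged into one kernel-verified Lean document; each statement's English description precedes it below -/
import Mathlib

section
/- (Base case of Lemma 2, time T.) Assume R : [0,1]^K → ℝ is regular (symmetric, nondecreasing in each argument, and decomposable) and bounded with constants Δ_l ≤ Δ_u. Let x, x̃ ∈ [0,1]^N satisfy x_k = x̃_k for all k ≠ j and x_j ≥ x̃_j. Then R applied to the first K entries of sort(x) minus R applied to the first K entries of sort(x̃) is at most Δ_u·(x_j − x̃_j), where sort(·) rearranges a vector in decreasing order. -/
/-- Sort the entries of a vector in decreasing order. -/
noncomputable def sortVec (N : ℕ) (v : Fin N → ℝ) : Fin N → ℝ :=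
  fun i => ((List.ofFn v).mergeSort (fun a b => decide (b ≤ a))).getD i.val 0

/-- The first `K` entries of a vector of length `N` (for `K ≤ N`). -/
noncomputable def firstK (N K : ℕ) (v : Fin N → ℝ) : Fin K → ℝ :=
  fun k => (List.ofFn v).getD k.val 0

/-- A vector sorted in decreasing order is antitone and is a rearrangement of the original. -/
theorem exists_perm_sortVec_eq (N : ℕ) (v : Fin N → ℝ) :
    ∃ σ : Equiv.Perm (Fin N), sortVec N v = v ∘ σ ∧ Antitone (sortVec N v) := by
  set σ := Tuple.sort (fun i => -v i)
  have hanti : Antitone (v ∘ σ) := fun i k hik => by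
    simpa using Tuple.monotone_sort (fun i => -v i) hik
  have hlist : (List.ofFn v).mergeSort (fun a b => decide (b ≤ a)) = List.ofFn (v ∘ σ) :=
    ((List.mergeSort_perm _ _).trans (σ.ofFn_comp_perm v).symm).eq_of_pairwise'
      List.sortedGE_mergeSort.pairwise hanti.sortedGE_ofFn.pairwise
  have hsort : sortVec N v = v ∘ σ := by
    funext i
    simp [sortVec, hlist]
  exact ⟨σ, hsort, hsort ▸ hanti⟩

theorem sortVec_mono (N : ℕ) {v w : Fin N → ℝ} (h : w ≤ v) : sortVec N w ≤ sortVec N v := by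
  obtain ⟨σ, hσ, hv⟩ := exists_perm_sortVec_eq N v
  obtain ⟨τ, hτ, hw⟩ := exists_perm_sortVec_eq N w
  intro i
  obtain ⟨m, hm, him⟩ : ∃ m ≤ i, i ≤ σ.symm (τ m) := by
    by_contra! hlt
    have hcard := Finset.card_le_card_of_injOn (s := Finset.Iic i) (t := Finset.Iio i)
      (fun m => σ.symm (τ m)) (fun m hm => by simpa using hlt m (by simpa using hm))
      (fun a _ b _ hab => by simpa using hab)
    simp at hcard
  calc sortVec N w i ≤ sortVec N w m := hw hm
    _ = w (τ m) := congrFun hτ m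
    _ ≤ v (τ m) := h _
    _ = sortVec N v (σ.symm (τ m)) := by simp [hσ]
    _ ≤ sortVec N v i := hv him

theorem sum_sortVec (N : ℕ) (v : Fin N → ℝ) : ∑ i, sortVec N v i = ∑ i, v i := by
  obtain ⟨σ, hσ, -⟩ := exists_perm_sortVec_eq N v
  rw [hσ]
  exact Equiv.sum_comp σ v

theorem sortVec_mem_Icc (N : ℕ) {v : Fin N → ℝ} {a b : ℝ} (h : ∀ i, v i ∈ Set.Icc a b)
    (i : Fin N) : sortVec N v i ∈ Set.Icc a b := by
  obtain ⟨σ, hσ, -⟩ := exists_perm_sortVec_eq N v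
  rw [hσ]
  exact h _

theorem firstK_eq_comp_castLE (N K : ℕ) (hKN : K ≤ N) (v : Fin N → ℝ) :
    firstK N K v = v ∘ Fin.castLE hKN := by
  funext k
  simp [firstK, k.isLt.trans_le hKN, Fin.castLE]

/-- A decomposable function on the unit cube whose increments are at most `Δ` is Lipschitz
from above: raising the arguments from `w` to `u` costs at most `Δ * ∑ k, (u k - w k)`. -/
theorem sub_le_mul_sum_of_decomposable {ι : Type*} [Fintype ι] [DecidableEq ι]
    {R : (ι → ℝ) → ℝ} {Δ : ℝ}
    (hdec : ∀ (j : ι) (x : ι → ℝ), (∀ k, x k ∈ Set.Icc (0 : ℝ) 1) →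
      R x = x j * R (Function.update x j 1) + (1 - x j) * R (Function.update x j 0))
    (hbound : ∀ (j : ι) (x : ι → ℝ), (∀ k, x k ∈ Set.Icc (0 : ℝ) 1) →
      R (Function.update x j 1) - R (Function.update x j 0) ≤ Δ)
    {u w : ι → ℝ} (hu : ∀ k, u k ∈ Set.Icc (0 : ℝ) 1) (hw : ∀ k, w k ∈ Set.Icc (0 : ℝ) 1)
    (hwu : w ≤ u) : R u - R w ≤ Δ * ∑ k, (u k - w k) := by
  suffices H : ∀ s : Finset ι, R (s.piecewise u w) - R w ≤ Δ * ∑ k ∈ s, (u k - w k) by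
    simpa using H Finset.univ
  intro s
  induction s using Finset.induction_on with
  | empty => simp
  | insert a s ha ih =>
    set y := s.piecewise u w
    have hy : ∀ k, y k ∈ Set.Icc (0 : ℝ) 1 := fun k => by
      by_cases hk : k ∈ s <;> simp [y, hk, hu k, hw k, -Set.mem_Icc]
    have hya : y a = w a := by simp [y, ha]
    have hz : ∀ k, Function.update y a (u a) k ∈ Set.Icc (0 : ℝ) 1 := fun k => by
      rcases eq_or_ne k a with rfl | hk
      · simpa using hu k
      · simpa [hk] using hy k
    have h1 := hdec a y hy
    have h2 := hdec a _ hz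
    simp only [Function.update_self, Function.update_idem] at h2
    rw [hya] at h1
    rw [Finset.piecewise_insert, Finset.sum_insert ha]
    have h3 := mul_le_mul_of_nonneg_right (hbound a y hy) (sub_nonneg.2 (hwu a))
    linarith

/-- Base case (time `T`) of Lemma 2: if `R` is regular (symmetric, nondecreasing in each
argument, decomposable) and bounded with constants `Δl ≤ Δu`, and `x, x̃` agree outside
coordinate `j` with `x_j ≥ x̃_j`, then `R` applied to the first `K` entries of `sort x`
minus `R` applied to the first `K` entries of `sort x̃` is at most `Δu·(x_j - x̃_j)`. -/
theorem reward_difference_bound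
    (N K : ℕ) (hK : 1 ≤ K) (hKN : K ≤ N)
    (R : (Fin K → ℝ) → ℝ)
    (hRsym : ∀ (σ : Equiv.Perm (Fin K)) (x : Fin K → ℝ), R (x ∘ σ) = R x)
    (hRmono : ∀ (j : Fin K) (x : Fin K → ℝ), (∀ k, x k ∈ Set.Icc (0 : ℝ) 1) →
      ∀ a b : ℝ, a ∈ Set.Icc (0 : ℝ) 1 → b ∈ Set.Icc (0 : ℝ) 1 → a ≤ b →
        R (Function.update x j a) ≤ R (Function.update x j b))
    (hRdec : ∀ (j : Fin K) (x : Fin K → ℝ), (∀ k, x k ∈ Set.Icc (0 : ℝ) 1) →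
      R x = x j * R (Function.update x j 1) + (1 - x j) * R (Function.update x j 0))
    (Δl Δu : ℝ) (hΔ : Δl ≤ Δu)
    (hRbound : ∀ (j : Fin K) (x : Fin K → ℝ), (∀ k, x k ∈ Set.Icc (0 : ℝ) 1) →
      Δl ≤ R (Function.update x j 1) - R (Function.update x j 0) ∧
        R (Function.update x j 1) - R (Function.update x j 0) ≤ Δu)
    (j : Fin N) (x xt : Fin N → ℝ)
    (hx : ∀ i, x i ∈ Set.Icc (0 : ℝ) 1) (hxt : ∀ i, xt i ∈ Set.Icc (0 : ℝ) 1)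
    (hagree : ∀ k, k ≠ j → x k = xt k) (hj : xt j ≤ x j) :
    R (firstK N K (sortVec N x)) - R (firstK N K (sortVec N xt)) ≤ Δu * (x j - xt j) := by
  have hle : xt ≤ x := fun k => by
    rcases eq_or_ne k j with rfl | hk
    · exact hj
    · exact (hagree k hk).ge
  have hsort := sortVec_mono N hle
  have hΔu : 0 ≤ Δu := by
    have h0 : ∀ k : Fin K, (0 : Fin K → ℝ) k ∈ Set.Icc (0 : ℝ) 1 := by simp
    have h1 := hRmono ⟨0, hK⟩ 0 h0 0 1 (by simp) (by simp) zero_le_one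
    linarith [(hRbound ⟨0, hK⟩ 0 h0).2]
  rw [firstK_eq_comp_castLE N K hKN, firstK_eq_comp_castLE N K hKN]
  refine (sub_le_mul_sum_of_decomposable hRdec (fun k y hy => (hRbound k y hy).2)
    (fun k => sortVec_mem_Icc N hx _) (fun k => sortVec_mem_Icc N hxt _)
    (fun k => hsort _)).trans (mul_le_mul_of_nonneg_left ?_ hΔu)
  calc ∑ k : Fin K, (sortVec N x (Fin.castLE hKN k) - sortVec N xt (Fin.castLE hKN k))
      = ∑ i ∈ Finset.univ.map (Fin.castLEEmb hKN), (sortVec N x i - sortVec N xt i) := by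
        simp
    _ ≤ ∑ i, (sortVec N x i - sortVec N xt i) :=
        Finset.sum_le_sum_of_subset_of_nonneg (Finset.subset_univ _)
          fun i _ _ => sub_nonneg.2 (hsort i)
    _ = ∑ i, (x i - xt i) := by
        simp only [Finset.sum_sub_distrib, sum_sortVec]
    _ = x j - xt j :=
        Finset.sum_eq_single j (fun k _ hk => sub_eq_zero.2 (hagree k hk)) (by simp)
end

section
/- (Lemma 3.) Assume R : [0,1]^K → ℝ is regular (symmetric, nondecreasing in each argument, and decomposable) and bounded with constants Δ_l ≤ Δ_u, that τ is a monotonically increasing contracting map, that β ≤ 1, and that Δ_l ≥ Δ_u·β·p·(1 − (β(1−p))^{T+1})/(1 − β(1−p)). Let s ∈ [0,1]^N and let Π be the transposition of indices i and j with j ≤ i and s_j ≥ s_i. Then W_n(s) − W_n(s_Π) ≥ 0 for every 1 ≤ n ≤ T, where s_Π is s with coordinates i and j transposed. -/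
/-- The set of scheduled indices `{1,…,K}` (the first `K` coordinates). -/
def sched (N K : ℕ) : Finset (Fin N) := Finset.univ.filter (fun i => i.val < K)

/-- The next belief vector `[T(v_Ē), 0(|E|)]`: the entries of `v` outside the active set `E`
are sorted in decreasing order, `τ` is applied to each, and `|E|` zeros are appended. -/
noncomputable def nextVec (N : ℕ) (τ : ℝ → ℝ) (E : Finset (Fin N)) (v : Fin N → ℝ) :
    Fin N → ℝ :=
  fun i => (((((Finset.univ \ E).sort (· ≤ ·)).map v).mergeSort
      (fun a b => decide (b ≤ a))).map τ).getD i.val 0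

/-- The pseudo value function, indexed by remaining time: `W … m v` is the pseudo value
function `W_n(v)` of the paper with `m = T - n` slots remaining after the current one;
`W … 0 v = R(v_1,…,v_K)` and
`W … (m+1) v = R(v_1,…,v_K) + β·Σ_{E ⊆ {1,…,K}} (1-p)^(K-|E|) p^|E| · W … m ([T(v_Ē), 0(|E|)])`. -/
noncomputable def W (N K : ℕ) (β p : ℝ) (τ : ℝ → ℝ) (R : (Fin K → ℝ) → ℝ) :
    ℕ → (Fin N → ℝ) → ℝ
  | 0, v => R (firstK N K v)
  | m + 1, v => R (firstK N K v) +
      β * ∑ E ∈ (sched N K).powerset,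
        ((1 - p) ^ (K - E.card) * p ^ E.card) * W N K β p τ R m (nextVec N τ E v)

section SortedLists

theorem orderedInsert_forall₂_ge {l₁ l₂ : List ℝ} (h : List.Forall₂ (· ≥ ·) l₁ l₂) :
    ∀ {a b : ℝ}, b ≤ a → l₁.Pairwise (· ≥ ·) → l₂.Pairwise (· ≥ ·) →
      List.Forall₂ (· ≥ ·) (l₁.orderedInsert (· ≥ ·) a) (l₂.orderedInsert (· ≥ ·) b) := by
  induction h with
  | nil => intro a b hab _ _; simpa using hab
  | @cons x y t₁ t₂ hxy ht ih =>
    intro a b hab h₁ h₂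
    have e₁ : t₁.orderedInsert (· ≥ ·) x = x :: t₁ := by
      simpa [h₁.of_cons.insertionSort_eq] using h₁.insertionSort_eq
    have e₂ : t₂.orderedInsert (· ≥ ·) y = y :: t₂ := by
      simpa [h₂.of_cons.insertionSort_eq] using h₂.insertionSort_eq
    have s₁ := h₁.of_cons
    have s₂ := h₂.of_cons
    rw [List.orderedInsert_cons, List.orderedInsert_cons]
    split_ifs with hax hby hby
    · exact .cons hab (.cons hxy ht)
    · refine .cons (le_trans hxy hax) ?_
      rw [← e₁]
      exact ih ((le_of_not_ge hby).trans hxy) s₁ s₂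
    · refine .cons (hab.trans (le_of_not_ge hax)) ?_
      rw [← e₂]
      exact ih (le_trans hby hab) s₁ s₂
    · exact .cons hxy (ih hab s₁ s₂)

theorem insertionSort_forall₂_ge {l₁ l₂ : List ℝ} (h : List.Forall₂ (· ≥ ·) l₁ l₂) :
    List.Forall₂ (· ≥ ·) (l₁.insertionSort (· ≥ ·)) (l₂.insertionSort (· ≥ ·)) := by
  induction h with
  | nil => simp
  | cons hxy _ ih =>
    exact orderedInsert_forall₂_ge ih hxy (List.pairwise_insertionSort _ _)
      (List.pairwise_insertionSort _ _)

theorem insertionSort_ge_eq_of_perm {l₁ l₂ : List ℝ} (h : l₁.Perm l₂) :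
    l₁.insertionSort (· ≥ ·) = l₂.insertionSort (· ≥ ·) :=
  List.Perm.eq_of_pairwise (fun _ _ _ _ h₁ h₂ => le_antisymm h₂ h₁)
    (List.pairwise_insertionSort _ _) (List.pairwise_insertionSort _ _)
    ((List.perm_insertionSort _ l₁).trans (h.trans (List.perm_insertionSort _ l₂).symm))

theorem forall₂_getD {α : Type*} {r : α → α → Prop} {l₁ l₂ : List α}
    (h : List.Forall₂ r l₁ l₂) {d : α} (hd : r d d) (n : ℕ) :
    r (l₁.getD n d) (l₂.getD n d) := by
  induction h generalizing n with
  | nil => simpa using hd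
  | cons hxy _ ih => cases n with
    | zero => simpa using hxy
    | succ n => simpa using ih n

theorem sum_fin_getD {M : Type*} [AddCommMonoid M] (l : List M) {N : ℕ} (h : l.length ≤ N) :
    ∑ i : Fin N, l.getD i.val 0 = l.sum := by
  induction l generalizing N with
  | nil => simp
  | cons a t ih =>
    obtain _ | N := N
    · simp at h
    · have := ih (N := N) (by simpa using h)
      rw [Fin.sum_univ_succ, List.sum_cons, ← this]
      simp

theorem sum_map_sub_sum_map_le {τ : ℝ → ℝ} {S : Set ℝ}
    (hτ : ∀ x ∈ S, ∀ y ∈ S, |τ x - τ y| ≤ |x - y|) {l₁ l₂ : List ℝ}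
    (h : List.Forall₂ (· ≥ ·) l₁ l₂) (h₁ : ∀ x ∈ l₁, x ∈ S) (h₂ : ∀ x ∈ l₂, x ∈ S) :
    (l₁.map τ).sum - (l₂.map τ).sum ≤ l₁.sum - l₂.sum := by
  induction h with
  | nil => simp
  | @cons x y t₁ t₂ hxy _ ih =>
    have hle := hτ x (h₁ x (by simp)) y (h₂ y (by simp))
    rw [abs_of_nonneg (sub_nonneg.2 hxy)] at hle
    have := ih (fun z hz => h₁ z (by simp [hz])) (fun z hz => h₂ z (by simp [hz]))
    have := le_of_abs_le hle
    simp only [List.map_cons, List.sum_cons]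
    linarith

end SortedLists

section NextVec

variable {N : ℕ}

/-- The decreasing list of the entries of `v` at the indices outside `E`. -/
noncomputable def idleList (E : Finset (Fin N)) (v : Fin N → ℝ) : List ℝ :=
  (((Finset.univ \ E).sort (· ≤ ·)).map v).insertionSort (· ≥ ·)

theorem nextVec_apply (τ : ℝ → ℝ) (E : Finset (Fin N)) (v : Fin N → ℝ) (i : Fin N) :
    nextVec N τ E v i = ((idleList E v).map τ).getD i.val 0 := by
  unfold nextVec idleList
  rw [← List.mergeSort_eq_insertionSort]

theorem mem_idleList {E : Finset (Fin N)} {v : Fin N → ℝ} {x : ℝ} :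
    x ∈ idleList E v ↔ ∃ i ∉ E, v i = x := by
  simp [idleList]

theorem sum_idleList (E : Finset (Fin N)) (v : Fin N → ℝ) :
    (idleList E v).sum = ∑ i ∈ Finset.univ \ E, v i := by
  rw [idleList, (List.perm_insertionSort _ _).sum_eq,
    ((Finset.sort_perm_toList _ _).map v).sum_eq, Finset.sum_map_toList]

theorem length_idleList_le (E : Finset (Fin N)) (v : Fin N → ℝ) :
    (idleList E v).length ≤ N := by
  simpa [idleList] using (Finset.card_le_univ (Finset.univ \ E))

theorem idleList_forall₂_ge {E : Finset (Fin N)} {u v : Fin N → ℝ} (h : ∀ i ∉ E, v i ≤ u i) :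
    List.Forall₂ (· ≥ ·) (idleList E u) (idleList E v) := by
  apply insertionSort_forall₂_ge
  rw [List.forall₂_map_left_iff, List.forall₂_map_right_iff, List.forall₂_same]
  intro i hi
  exact h i (by simpa using hi)

theorem nextVec_comp_equiv (τ : ℝ → ℝ) (E : Finset (Fin N)) (v : Fin N → ℝ)
    (σ : Equiv.Perm (Fin N)) :
    nextVec N τ E (v ∘ σ) = nextVec N τ (E.map σ.toEmbedding) v := by
  have h : idleList E (v ∘ σ) = idleList (E.map σ.toEmbedding) v := by
    apply insertionSort_ge_eq_of_perm
    have hc : Finset.univ \ E.map σ.toEmbedding = (Finset.univ \ E).map σ.toEmbedding := by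
      ext i
      simp [Finset.mem_map_equiv]
    rw [hc, ← Multiset.coe_eq_coe, ← Multiset.map_coe, ← Multiset.map_coe, Finset.sort_eq,
      Finset.sort_eq]
    simp
  ext i
  rw [nextVec_apply, nextVec_apply, h]

theorem nextVec_mem_Icc {τ : ℝ → ℝ} (hτ : ∀ x ∈ Set.Icc (0 : ℝ) 1, τ x ∈ Set.Icc (0 : ℝ) 1)
    (E : Finset (Fin N)) {v : Fin N → ℝ} (hv : ∀ i, v i ∈ Set.Icc (0 : ℝ) 1) (i : Fin N) :
    nextVec N τ E v i ∈ Set.Icc (0 : ℝ) 1 := by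
  rw [nextVec_apply]
  refine forall₂_getD (r := fun a _ => a ∈ Set.Icc (0 : ℝ) 1) (List.forall₂_same.2 ?_)
    (by simp) i.val
  intro x hx
  obtain ⟨y, hy, rfl⟩ := List.mem_map.1 hx
  obtain ⟨k, -, rfl⟩ := mem_idleList.1 hy
  exact hτ _ (hv k)

theorem nextVec_le_nextVec {τ : ℝ → ℝ} (hτ : MonotoneOn τ (Set.Icc 0 1))
    {E : Finset (Fin N)} {u v : Fin N → ℝ} (hu : ∀ i, u i ∈ Set.Icc (0 : ℝ) 1)
    (hv : ∀ i, v i ∈ Set.Icc (0 : ℝ) 1) (h : ∀ i ∉ E, v i ≤ u i) (i : Fin N) :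
    nextVec N τ E v i ≤ nextVec N τ E u i := by
  rw [nextVec_apply, nextVec_apply]
  refine forall₂_getD (r := (· ≥ ·)) ?_ le_rfl i.val
  rw [List.forall₂_map_left_iff, List.forall₂_map_right_iff, List.forall₂_iff_get]
  refine ⟨(idleList_forall₂_ge h).length_eq, fun k hk₁ hk₂ => ?_⟩
  obtain ⟨a, -, ha⟩ := mem_idleList.1 (List.get_mem (idleList E u) ⟨k, hk₁⟩)
  obtain ⟨b, -, hb⟩ := mem_idleList.1 (List.get_mem (idleList E v) ⟨k, hk₂⟩)
  exact hτ (hb ▸ hv b) (ha ▸ hu a) ((idleList_forall₂_ge h).get hk₁ hk₂)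

theorem sum_nextVec_sub_le {τ : ℝ → ℝ}
    (hτ : ∀ x ∈ Set.Icc (0 : ℝ) 1, ∀ y ∈ Set.Icc (0 : ℝ) 1, |τ x - τ y| ≤ |x - y|)
    {E : Finset (Fin N)} {u v : Fin N → ℝ} (hu : ∀ i, u i ∈ Set.Icc (0 : ℝ) 1)
    (hv : ∀ i, v i ∈ Set.Icc (0 : ℝ) 1) (h : ∀ i ∉ E, v i ≤ u i) :
    ∑ i, (nextVec N τ E u i - nextVec N τ E v i) ≤ ∑ i ∈ Finset.univ \ E, (u i - v i) := by
  have hmem : ∀ w : Fin N → ℝ, (∀ i, w i ∈ Set.Icc (0 : ℝ) 1) →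
      ∀ x ∈ idleList E w, x ∈ Set.Icc (0 : ℝ) 1 := by
    intro w hw x hx
    obtain ⟨k, -, rfl⟩ := mem_idleList.1 hx
    exact hw k
  simp only [nextVec_apply]
  rw [Finset.sum_sub_distrib, Finset.sum_sub_distrib,
    sum_fin_getD _ (by simpa using length_idleList_le E u),
    sum_fin_getD _ (by simpa using length_idleList_le E v), ← sum_idleList, ← sum_idleList]
  exact sum_map_sub_sum_map_le hτ (idleList_forall₂_ge h) (hmem u hu) (hmem v hv)

end NextVec

section ActivityWeights

theorem sum_powerset_weight {ι : Type*} (S : Finset ι) (p : ℝ) :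
    ∑ E ∈ S.powerset, (1 - p) ^ (S.card - E.card) * p ^ E.card = 1 := by
  have := Finset.sum_pow_mul_eq_add_pow p (1 - p) S
  simpa [mul_comm] using this

theorem sum_powerset_weight_mem {ι : Type*} [DecidableEq ι] {S : Finset ι} {i : ι} (hi : i ∈ S)
    (p : ℝ) :
    ∑ E ∈ S.powerset, (1 - p) ^ (S.card - E.card) * p ^ E.card * (if i ∈ E then 1 else 0) = p := by
  obtain ⟨S', hi', rfl⟩ : ∃ S', i ∉ S' ∧ insert i S' = S :=
    ⟨S.erase i, Finset.notMem_erase i S, Finset.insert_erase hi⟩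
  rw [Finset.sum_powerset_insert hi', Finset.sum_eq_zero, zero_add]
  · calc _ = ∑ E ∈ S'.powerset, p * ((1 - p) ^ (S'.card - E.card) * p ^ E.card) := by
          refine Finset.sum_congr rfl fun E hE => ?_
          have : i ∉ E := fun h => hi' (Finset.mem_powerset.1 hE h)
          rw [Finset.card_insert_of_notMem hi', Finset.card_insert_of_notMem this]
          simp [pow_succ]
          ring
      _ = p := by rw [← Finset.mul_sum, sum_powerset_weight, mul_one]
  · intro E hE
    have : i ∉ E := fun h => hi' (Finset.mem_powerset.1 hE h)
    simp [this]

theorem sum_powerset_weight_sum_compl {ι : Type*} [Fintype ι] [DecidableEq ι] (S : Finset ι)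
    (p : ℝ) (d : ι → ℝ) :
    ∑ E ∈ S.powerset, (1 - p) ^ (S.card - E.card) * p ^ E.card * ∑ i ∈ Finset.univ \ E, d i =
      ∑ i, d i - p * ∑ i ∈ S, d i := by
  have h : ∀ E ∈ S.powerset, ∑ i ∈ Finset.univ \ E, d i =
      ∑ i, d i - ∑ i ∈ S, d i * (if i ∈ E then 1 else 0) := by
    intro E hE
    rw [Finset.sum_sdiff_eq_sub (Finset.subset_univ E)]
    simp [Finset.inter_eq_right.2 (Finset.mem_powerset.1 hE)]
  calc _ = ∑ E ∈ S.powerset, ((1 - p) ^ (S.card - E.card) * p ^ E.card * ∑ i, d i -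
        ∑ i ∈ S, d i * ((1 - p) ^ (S.card - E.card) * p ^ E.card * (if i ∈ E then 1 else 0))) := by
        refine Finset.sum_congr rfl fun E hE => ?_
        rw [h E hE, mul_sub, Finset.mul_sum S]
        congr 1
        exact Finset.sum_congr rfl fun i _ => by ring
    _ = _ := by
        rw [Finset.sum_sub_distrib, ← Finset.sum_mul, sum_powerset_weight, one_mul,
          Finset.sum_comm, Finset.mul_sum]
        congr 1
        refine Finset.sum_congr rfl fun i hi => ?_
        rw [← Finset.mul_sum, sum_powerset_weight_mem hi, mul_comm]

end ActivityWeights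

section Reward

variable {ι : Type*} [DecidableEq ι] {R : (ι → ℝ) → ℝ}

theorem decomposable_update_sub
    (hR : ∀ (j : ι) (x : ι → ℝ), (∀ k, x k ∈ Set.Icc (0 : ℝ) 1) →
      R x = x j * R (Function.update x j 1) + (1 - x j) * R (Function.update x j 0))
    (j : ι) {x : ι → ℝ} (hx : ∀ k, x k ∈ Set.Icc (0 : ℝ) 1) {a b : ℝ}
    (ha : a ∈ Set.Icc (0 : ℝ) 1) (hb : b ∈ Set.Icc (0 : ℝ) 1) :
    R (Function.update x j a) - R (Function.update x j b) =
      (a - b) * (R (Function.update x j 1) - R (Function.update x j 0)) := by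
  have key : ∀ c ∈ Set.Icc (0 : ℝ) 1, R (Function.update x j c) =
      c * R (Function.update x j 1) + (1 - c) * R (Function.update x j 0) := by
    intro c hc
    have := hR j (Function.update x j c) fun k => by
      rcases eq_or_ne k j with rfl | hk
      · simpa using hc
      · simpa [hk] using hx k
    simpa using this
  rw [key a ha, key b hb]
  ring

theorem decomposable_sub_le [Fintype ι] {Δu : ℝ}
    (hR : ∀ (j : ι) (x : ι → ℝ), (∀ k, x k ∈ Set.Icc (0 : ℝ) 1) →
      R x = x j * R (Function.update x j 1) + (1 - x j) * R (Function.update x j 0))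
    (hb : ∀ (j : ι) (x : ι → ℝ), (∀ k, x k ∈ Set.Icc (0 : ℝ) 1) →
      R (Function.update x j 1) - R (Function.update x j 0) ≤ Δu)
    {x y : ι → ℝ} (hx : ∀ k, x k ∈ Set.Icc (0 : ℝ) 1) (hy : ∀ k, y k ∈ Set.Icc (0 : ℝ) 1)
    (hyx : ∀ k, y k ≤ x k) :
    R x - R y ≤ Δu * ∑ k, (x k - y k) := by
  suffices h : ∀ S : Finset ι, R (S.piecewise x y) - R y ≤ Δu * ∑ k ∈ S, (x k - y k) by
    simpa using h Finset.univ
  intro S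
  induction S using Finset.induction_on with
  | empty => simp
  | insert j S hj ih =>
    have hz : ∀ k, S.piecewise x y k ∈ Set.Icc (0 : ℝ) 1 := by
      intro k
      by_cases hk : k ∈ S <;> simp only [hk, Finset.piecewise_eq_of_mem,
        Finset.piecewise_eq_of_notMem, not_false_eq_true, hx k, hy k]
    have hd := decomposable_update_sub hR j hz (hx j) (hy j)
    have hself : Function.update (S.piecewise x y) j (y j) = S.piecewise x y := by
      rw [Function.update_eq_self_iff, Finset.piecewise_eq_of_notMem _ _ _ hj]
    have hle := mul_le_mul_of_nonneg_left (hb j _ hz) (sub_nonneg.2 (hyx j))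
    rw [hself] at hd
    rw [Finset.piecewise_insert, Finset.sum_insert hj]
    linarith

end Reward

section FirstK

variable {N K : ℕ}

theorem mem_sched {i : Fin N} : i ∈ sched N K ↔ i.val < K := by
  simp [sched]

theorem firstK_apply (h : K ≤ N) (v : Fin N → ℝ) (k : Fin K) :
    firstK N K v k = v (Fin.castLE h k) := by
  have hk : k.val < N := k.isLt.trans_le h
  simp [firstK, hk, Fin.castLE]

theorem sched_eq_map (h : K ≤ N) : sched N K = Finset.univ.map (Fin.castLEEmb h) := by
  ext i
  rw [mem_sched]
  simp only [Finset.mem_map, Finset.mem_univ, true_and]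
  exact ⟨fun hi => ⟨⟨i, hi⟩, rfl⟩, by rintro ⟨k, rfl⟩; exact k.isLt⟩

theorem card_sched (h : K ≤ N) : (sched N K).card = K := by
  simp [sched_eq_map h]

theorem sum_firstK_sub (h : K ≤ N) (u v : Fin N → ℝ) :
    ∑ k, (firstK N K u k - firstK N K v k) = ∑ i ∈ sched N K, (u i - v i) := by
  simp [sched_eq_map h, firstK_apply h]

end FirstK

section PseudoValue

variable {N K : ℕ} {β p : ℝ} {τ : ℝ → ℝ} {R : (Fin K → ℝ) → ℝ}

theorem W_succ_sub (m : ℕ) (u v : Fin N → ℝ) :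
    W N K β p τ R (m + 1) u - W N K β p τ R (m + 1) v =
      (R (firstK N K u) - R (firstK N K v)) + β * ∑ E ∈ (sched N K).powerset,
        (1 - p) ^ (K - E.card) * p ^ E.card *
          (W N K β p τ R m (nextVec N τ E u) - W N K β p τ R m (nextVec N τ E v)) := by
  simp only [W, mul_sub, Finset.sum_sub_distrib]
  ring

theorem W_comp_perm_of_sched (hKN : K ≤ N)
    (hRsym : ∀ (σ : Equiv.Perm (Fin K)) (x : Fin K → ℝ), R (x ∘ σ) = R x)
    (σ : Equiv.Perm (Fin N)) (hσ : ∀ i, σ i ∈ sched N K ↔ i ∈ sched N K) (m : ℕ)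
    (s : Fin N → ℝ) :
    W N K β p τ R m (s ∘ σ) = W N K β p τ R m s := by
  have hσ' : ∀ i, σ.symm i ∈ sched N K ↔ i ∈ sched N K := fun i => by
    rw [← hσ (σ.symm i), Equiv.apply_symm_apply]
  have hlt : ∀ k : Fin K, Fin.castLE hKN k ∈ sched N K := fun k => mem_sched.2 k.isLt
  let ρ : Equiv.Perm (Fin K) :=
    { toFun := fun k => ⟨σ (Fin.castLE hKN k), mem_sched.1 ((hσ _).2 (hlt k))⟩
      invFun := fun k => ⟨σ.symm (Fin.castLE hKN k), mem_sched.1 ((hσ' _).2 (hlt k))⟩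
      left_inv := fun k => by simp
      right_inv := fun k => by simp }
  have hfirst : R (firstK N K (s ∘ σ)) = R (firstK N K s) := by
    rw [← hRsym ρ (firstK N K s)]
    congr 1
    ext k
    simp only [Function.comp_apply, firstK_apply hKN]
    rfl
  cases m with
  | zero => exact hfirst
  | succ m =>
    simp only [W, hfirst]
    congr 2
    refine Finset.sum_equiv σ.finsetCongr (fun E => ?_) (fun E _ => ?_)
    · simp only [Finset.mem_powerset, Finset.subset_iff, Equiv.finsetCongr_apply,
        Finset.mem_map_equiv]
      exact ⟨fun h i hi => (hσ' i).1 (h hi),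
        fun h i hi => (hσ i).1 (h (by simpa using hi))⟩
    · simp [nextVec_comp_equiv]

theorem W_sub_le (hKN : K ≤ N) (hβ0 : 0 ≤ β) (hp0 : 0 ≤ p) (hp1 : p ≤ 1)
    (hRdec : ∀ (j : Fin K) (x : Fin K → ℝ), (∀ k, x k ∈ Set.Icc (0 : ℝ) 1) →
      R x = x j * R (Function.update x j 1) + (1 - x j) * R (Function.update x j 0))
    {Δu : ℝ} (hΔu : 0 ≤ Δu)
    (hRbound : ∀ (j : Fin K) (x : Fin K → ℝ), (∀ k, x k ∈ Set.Icc (0 : ℝ) 1) →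
      R (Function.update x j 1) - R (Function.update x j 0) ≤ Δu)
    (hτmap : ∀ x ∈ Set.Icc (0 : ℝ) 1, τ x ∈ Set.Icc (0 : ℝ) 1)
    (hτmono : MonotoneOn τ (Set.Icc 0 1))
    (hτcon : ∀ x ∈ Set.Icc (0 : ℝ) 1, ∀ y ∈ Set.Icc (0 : ℝ) 1, |τ x - τ y| ≤ |x - y|)
    (m : ℕ)
    (hcond : ∀ k ≤ m, β * p * (Δu * ∑ l ∈ Finset.range k, (β * (1 - p)) ^ l) ≤ Δu)
    {u v : Fin N → ℝ} (hu : ∀ i, u i ∈ Set.Icc (0 : ℝ) 1) (hv : ∀ i, v i ∈ Set.Icc (0 : ℝ) 1)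
    (hvu : ∀ i, v i ≤ u i) :
    W N K β p τ R m u - W N K β p τ R m v ≤
      (Δu * ∑ l ∈ Finset.range (m + 1), (β * (1 - p)) ^ l) * ∑ i, (u i - v i) := by
  induction m generalizing u v with
  | zero =>
    have hR := decomposable_sub_le hRdec hRbound (x := firstK N K u) (y := firstK N K v)
      (fun k => by simpa only [firstK_apply hKN] using hu _)
      (fun k => by simpa only [firstK_apply hKN] using hv _)
      (fun k => by simpa only [firstK_apply hKN] using hvu _)
    rw [sum_firstK_sub hKN] at hR
    have hS : ∑ i ∈ sched N K, (u i - v i) ≤ ∑ i, (u i - v i) :=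
      Finset.sum_le_univ_sum_of_nonneg fun i => sub_nonneg.2 (hvu i)
    simpa [W] using hR.trans (mul_le_mul_of_nonneg_left hS hΔu)
  | succ m ih =>
    have hR := decomposable_sub_le hRdec hRbound (x := firstK N K u) (y := firstK N K v)
      (fun k => by simpa only [firstK_apply hKN] using hu _)
      (fun k => by simpa only [firstK_apply hKN] using hv _)
      (fun k => by simpa only [firstK_apply hKN] using hvu _)
    rw [sum_firstK_sub hKN] at hR
    have hS : ∑ i ∈ sched N K, (u i - v i) ≤ ∑ i, (u i - v i) :=
      Finset.sum_le_univ_sum_of_nonneg fun i => sub_nonneg.2 (hvu i)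
    have hc := hcond (m + 1) le_rfl
    have hq : 0 ≤ 1 - p := sub_nonneg.2 hp1
    set C := Δu * ∑ l ∈ Finset.range (m + 1), (β * (1 - p)) ^ l with hC
    have hC0 : 0 ≤ C := by positivity
    have hCsucc : Δu * ∑ l ∈ Finset.range (m + 1 + 1), (β * (1 - p)) ^ l =
        Δu + β * (1 - p) * C := by
      rw [Finset.sum_range_succ', hC, Finset.sum_congr rfl fun l _ => pow_succ' _ l,
        ← Finset.mul_sum]
      ring
    have hsum : ∑ E ∈ (sched N K).powerset, (1 - p) ^ (K - E.card) * p ^ E.card *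
          (W N K β p τ R m (nextVec N τ E u) - W N K β p τ R m (nextVec N τ E v)) ≤
        C * (∑ i, (u i - v i) - p * ∑ i ∈ sched N K, (u i - v i)) := by
      rw [← sum_powerset_weight_sum_compl, card_sched hKN, Finset.mul_sum]
      refine Finset.sum_le_sum fun E _ => ?_
      have h₁ := ih (fun k hk => hcond k (hk.trans m.le_succ))
        (nextVec_mem_Icc hτmap E hu) (nextVec_mem_Icc hτmap E hv)
        (nextVec_le_nextVec hτmono hu hv fun i _ => hvu i)
      have h₂ := sum_nextVec_sub_le hτcon hu hv (E := E) fun i _ => hvu i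
      rw [mul_left_comm]
      gcongr
      exact h₁.trans (mul_le_mul_of_nonneg_left h₂ hC0)
    rw [W_succ_sub, hCsucc]
    have := mul_le_mul_of_nonneg_left hsum hβ0
    nlinarith [mul_nonneg (sub_nonneg.2 hc) (sub_nonneg.2 hS)]

theorem W_swap_sched_nonneg (hKN : K ≤ N) (hβ0 : 0 ≤ β) (hp0 : 0 ≤ p) (hp1 : p ≤ 1)
    (hRdec : ∀ (j : Fin K) (x : Fin K → ℝ), (∀ k, x k ∈ Set.Icc (0 : ℝ) 1) →
      R x = x j * R (Function.update x j 1) + (1 - x j) * R (Function.update x j 0))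
    {Δl Δu : ℝ} (hΔl : 0 ≤ Δl) (hΔ : Δl ≤ Δu)
    (hRbound : ∀ (j : Fin K) (x : Fin K → ℝ), (∀ k, x k ∈ Set.Icc (0 : ℝ) 1) →
      Δl ≤ R (Function.update x j 1) - R (Function.update x j 0) ∧
        R (Function.update x j 1) - R (Function.update x j 0) ≤ Δu)
    (hτmap : ∀ x ∈ Set.Icc (0 : ℝ) 1, τ x ∈ Set.Icc (0 : ℝ) 1)
    (hτmono : MonotoneOn τ (Set.Icc 0 1))
    (hτcon : ∀ x ∈ Set.Icc (0 : ℝ) 1, ∀ y ∈ Set.Icc (0 : ℝ) 1, |τ x - τ y| ≤ |x - y|)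
    (m : ℕ)
    (hcond : ∀ k ≤ m, β * p * (Δu * ∑ l ∈ Finset.range k, (β * (1 - p)) ^ l) ≤ Δl)
    {s : Fin N → ℝ} (hs : ∀ i, s i ∈ Set.Icc (0 : ℝ) 1) {i j : Fin N}
    (hj : j ∈ sched N K) (hi : i ∉ sched N K) (hsji : s i ≤ s j) :
    0 ≤ W N K β p τ R m s - W N K β p τ R m (s ∘ Equiv.swap i j) := by
  have hij : i ≠ j := fun h => hi (h ▸ hj)
  set s' := s ∘ Equiv.swap i j with hs'_def
  have hs' : ∀ k, s' k ∈ Set.Icc (0 : ℝ) 1 := fun k => hs _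
  have hs'j : s' j = s i := by simp [s']
  have hs'i : s' i = s j := by simp [s']
  have hs'k : ∀ k, k ≠ i → k ≠ j → s' k = s k := fun k h₁ h₂ => by
    simp [s', Equiv.swap_apply_of_ne_of_ne h₁ h₂]
  have hR : Δl * (s j - s i) ≤ R (firstK N K s) - R (firstK N K s') := by
    let j' : Fin K := ⟨j, mem_sched.1 hj⟩
    have hx : ∀ k, firstK N K s k ∈ Set.Icc (0 : ℝ) 1 := fun k => by
      simpa only [firstK_apply hKN] using hs _
    have h₁ : Function.update (firstK N K s) j' (s j) = firstK N K s := by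
      rw [Function.update_eq_self_iff, firstK_apply hKN]
      rfl
    have h₂ : Function.update (firstK N K s) j' (s i) = firstK N K s' := by
      ext k
      rcases eq_or_ne k j' with rfl | hk
      · rw [Function.update_self, firstK_apply hKN, ← hs'j]
        rfl
      · rw [Function.update_of_ne hk, firstK_apply hKN, firstK_apply hKN, hs'k]
        · rintro rfl
          exact hi (mem_sched.2 k.isLt)
        · rintro rfl
          exact hk rfl
    have h := decomposable_update_sub hRdec j' hx (hs j) (hs i)
    rw [h₁, h₂] at h
    rw [h, mul_comm]
    exact mul_le_mul_of_nonneg_left (hRbound j' _ hx).1 (sub_nonneg.2 hsji)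
  cases m with
  | zero => exact (mul_nonneg hΔl (sub_nonneg.2 hsji)).trans hR
  | succ m =>
    set C := Δu * ∑ l ∈ Finset.range (m + 1), (β * (1 - p)) ^ l with hC
    have hq : 0 ≤ 1 - p := sub_nonneg.2 hp1
    have hΔu : 0 ≤ Δu := hΔl.trans hΔ
    have hC0 : 0 ≤ C := by positivity
    have hE : ∀ E ∈ (sched N K).powerset, -(C * (s j - s i)) * (if j ∈ E then 1 else 0) ≤
        W N K β p τ R m (nextVec N τ E s) - W N K β p τ R m (nextVec N τ E s') := by
      intro E hE
      have hiE : i ∉ E := fun h => hi (Finset.mem_powerset.1 hE h)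
      by_cases hjE : j ∈ E
      · have hle : ∀ k ∉ E, s k ≤ s' k := by
          intro k hk
          rcases eq_or_ne k i with rfl | hki
          · rw [hs'i]
            exact hsji
          · rw [hs'k k hki fun h => hk (h ▸ hjE)]
        have hsum : ∑ k ∈ Finset.univ \ E, (s' k - s k) = s j - s i := by
          rw [Finset.sum_eq_single i, hs'i]
          · intro k hk hki
            rw [hs'k k hki, sub_self]
            rintro rfl
            simp [hjE] at hk
          · simp [hiE]
        have h₁ := W_sub_le hKN hβ0 hp0 hp1 hRdec hΔu (fun j x hx => (hRbound j x hx).2)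
          hτmap hτmono hτcon m (fun k hk => (hcond k (hk.trans m.le_succ)).trans hΔ)
          (nextVec_mem_Icc hτmap E hs') (nextVec_mem_Icc hτmap E hs)
          (nextVec_le_nextVec hτmono hs' hs hle)
        have h₂ := mul_le_mul_of_nonneg_left (sum_nextVec_sub_le hτcon hs' hs hle) hC0
        rw [hsum] at h₂
        simp only [hjE, if_true, mul_one]
        linarith
      · have hmap : E.map (Equiv.swap i j).toEmbedding = E := by
          ext k
          rw [Finset.mem_map_equiv, Equiv.symm_swap]
          rcases eq_or_ne k i with rfl | hki
          · simp [hiE, hjE]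
          · rcases eq_or_ne k j with rfl | hkj
            · simp [hiE, hjE]
            · rw [Equiv.swap_apply_of_ne_of_ne hki hkj]
        rw [hs'_def, nextVec_comp_equiv, hmap]
        simp [hjE]
    have hsum : -(C * (s j - s i)) * p ≤
        ∑ E ∈ (sched N K).powerset, (1 - p) ^ (K - E.card) * p ^ E.card *
          (W N K β p τ R m (nextVec N τ E s) - W N K β p τ R m (nextVec N τ E s')) := by
      conv_lhs => rw [← sum_powerset_weight_mem hj p]
      rw [card_sched hKN, Finset.mul_sum]
      refine Finset.sum_le_sum fun E h => ?_
      rw [mul_left_comm]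
      exact mul_le_mul_of_nonneg_left (hE E h) (by positivity)
    rw [W_succ_sub]
    have h₁ := mul_le_mul_of_nonneg_left hsum hβ0
    have h₂ := mul_le_mul_of_nonneg_right (hcond (m + 1) le_rfl) (sub_nonneg.2 hsji)
    linarith

end PseudoValue

/-- Lemma 3: if `R` is regular and bounded with constants `Δl ≤ Δu`, `τ` is a monotonically
increasing contracting map, `β ≤ 1`, and
`Δl ≥ Δu·β·p·(1 - (β(1-p))^(T+1))/(1 - β(1-p))`, then for any belief vector `s` and any
transposition of coordinates `i, j` with `j ≤ i` and `s_j ≥ s_i`, `W_n(s) - W_n(s_Π) ≥ 0`. -/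
theorem pseudo_value_swap_nonneg
    (N K T : ℕ) (hK : 1 ≤ K) (hKN : K ≤ N) (hT : 1 ≤ T)
    (β p : ℝ) (hβ0 : 0 < β) (hβ1 : β ≤ 1) (hp0 : 0 ≤ p) (hp1 : p ≤ 1)
    (τ : ℝ → ℝ) (R : (Fin K → ℝ) → ℝ)
    (hRsym : ∀ (σ : Equiv.Perm (Fin K)) (x : Fin K → ℝ), R (x ∘ σ) = R x)
    (hRmono : ∀ (j : Fin K) (x : Fin K → ℝ), (∀ k, x k ∈ Set.Icc (0 : ℝ) 1) →
      ∀ a b : ℝ, a ∈ Set.Icc (0 : ℝ) 1 → b ∈ Set.Icc (0 : ℝ) 1 → a ≤ b →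
        R (Function.update x j a) ≤ R (Function.update x j b))
    (hRdec : ∀ (j : Fin K) (x : Fin K → ℝ), (∀ k, x k ∈ Set.Icc (0 : ℝ) 1) →
      R x = x j * R (Function.update x j 1) + (1 - x j) * R (Function.update x j 0))
    (Δl Δu : ℝ) (hΔ : Δl ≤ Δu)
    (hRbound : ∀ (j : Fin K) (x : Fin K → ℝ), (∀ k, x k ∈ Set.Icc (0 : ℝ) 1) →
      Δl ≤ R (Function.update x j 1) - R (Function.update x j 0) ∧
        R (Function.update x j 1) - R (Function.update x j 0) ≤ Δu)
    (hτmap : ∀ x ∈ Set.Icc (0 : ℝ) 1, τ x ∈ Set.Icc (0 : ℝ) 1)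
    (hτmono : ∀ x ∈ Set.Icc (0 : ℝ) 1, ∀ y ∈ Set.Icc (0 : ℝ) 1, y < x → τ y < τ x)
    (hτcon : ∀ x ∈ Set.Icc (0 : ℝ) 1, ∀ y ∈ Set.Icc (0 : ℝ) 1, |τ x - τ y| ≤ |x - y|)
    (hcond : Δu * β * p * ((1 - (β * (1 - p)) ^ (T + 1)) / (1 - β * (1 - p))) ≤ Δl)
    (s : Fin N → ℝ) (hs : ∀ i, s i ∈ Set.Icc (0 : ℝ) 1)
    (i j : Fin N) (hji : j ≤ i) (hsji : s i ≤ s j)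
    (n : ℕ) (hn1 : 1 ≤ n) (hnT : n ≤ T) :
    0 ≤ W N K β p τ R (T - n) s - W N K β p τ R (T - n) (s ∘ Equiv.swap i j) := by
  obtain ⟨hΔl, hcond'⟩ : 0 ≤ Δl ∧ ∀ k ≤ T,
      β * p * (Δu * ∑ l ∈ Finset.range k, (β * (1 - p)) ^ l) ≤ Δl := by
    have hΔu : 0 ≤ Δu := by
      have h0 : ∀ k : Fin K, (0 : Fin K → ℝ) k ∈ Set.Icc (0 : ℝ) 1 := fun k => by simp
      exact (sub_nonneg.2 (hRmono ⟨0, hK⟩ 0 h0 0 1 (by simp) (by simp) zero_le_one)).trans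
        (hRbound ⟨0, hK⟩ 0 h0).2
    have hq : 0 ≤ 1 - p := sub_nonneg.2 hp1
    have hlast : β * p * (Δu * ∑ l ∈ Finset.range (T + 1), (β * (1 - p)) ^ l) ≤ Δl := by
      by_cases hr : β * (1 - p) = 1
      · have hp : p = 0 := by nlinarith
        simpa [hp] using hcond
      · rw [geom_sum_eq hr, ← neg_div_neg_eq, neg_sub, neg_sub]
        linarith
    refine ⟨le_trans (by positivity) hlast, fun k hk => le_trans ?_ hlast⟩
    gcongr
    omega
  have hmono : MonotoneOn τ (Set.Icc 0 1) :=
    StrictMonoOn.monotoneOn fun x hx y hy hxy => hτmono y hy x hx hxy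
  by_cases hij : i ∈ sched N K ↔ j ∈ sched N K
  · rw [W_comp_perm_of_sched hKN hRsym (Equiv.swap i j), sub_self]
    intro k
    rcases eq_or_ne k i with rfl | hki
    · rw [Equiv.swap_apply_left, hij]
    · rcases eq_or_ne k j with rfl | hkj
      · rw [Equiv.swap_apply_right, hij]
      · rw [Equiv.swap_apply_of_ne_of_ne hki hkj]
  · have h : j ∈ sched N K ∧ i ∉ sched N K := by
      have : i ∈ sched N K → j ∈ sched N K := fun hi =>
        mem_sched.2 (lt_of_le_of_lt hji (mem_sched.1 hi))
      tauto
    exact W_swap_sched_nonneg hKN hβ0.le hp0 hp1 hRdec hΔl hΔ hRbound hτmap hmono hτcon (T - n)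
      (fun k hk => hcond' k (hk.trans (Nat.sub_le T n))) hs h.1 h.2 hsji
end
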